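/- Let d ≥ 2, N, M ≥ 2 be integers with N(M−1) = d²−1, let {E_{α,k}} be an informationally complete (N,M)-POVM on ℂ^d with parameter x, take O^{(α)} = I_M for every α, let 1 ≤ k ≤ d, let h_x = (1/(kd−1))·√(M(M−1)/(x(M²x−d))), and let W_k be the associated witness operator. For v ∈ (0,1] let ρ_v = v·|ψ_d⟩⟨ψ_d| + ((1−v)/d²)·I_{d²} with |ψ_d⟩ = (1/√d)·∑_{i=0}^{d−1}|i⟩⊗|i⟩. If v > M(kd−1)·√(x(M²x−d)) / ( N(M²x−d)·√(M(M−1)) ), then Tr(W_k ρ_v) < 0. -/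

import Mathlib

open Matrix Kronecker
open scoped ComplexOrder

noncomputable section

/-- Informationally complete (N,M)-POVM on ℂ^d with parameter x. -/
def IsICPOVM (d N M : ℕ) (x : ℝ)
    (E : Fin N → Fin M → Matrix (Fin d) (Fin d) ℂ) : Prop :=
  (∀ α k, (E α k).PosSemidef) ∧
  (∀ α, ∑ k, E α k = 1) ∧
  (∀ α k, (E α k).trace = (d : ℂ) / M) ∧
  (∀ α k, (E α k * E α k).trace = (x : ℂ)) ∧
  (∀ α k l, k ≠ l → (E α k * E α l).trace = ((d : ℂ) - M * x) / (M * (M - 1))) ∧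
  (∀ α β k l, α ≠ β → (E α k * E β l).trace = (d : ℂ) / (M : ℂ) ^ 2) ∧
  ((d : ℝ) / (M : ℝ) ^ 2 < x ∧ x ≤ min ((d : ℝ) ^ 2 / (M : ℝ) ^ 2) ((d : ℝ) / M))

/-- The constant h_x. -/
def hx (d M k : ℕ) (x : ℝ) : ℝ :=
  (1 / ((k : ℝ) * d - 1)) *
    Real.sqrt (((M : ℝ) * ((M : ℝ) - 1)) / (x * ((M : ℝ) ^ 2 * x - d)))

/-- The linear map Λ associated to the POVM, the rotations and the constant h. -/
def LamMap {d N M : ℕ} (E : Fin N → Fin M → Matrix (Fin d) (Fin d) ℂ)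
    (O : Fin N → Matrix (Fin M) (Fin M) ℝ) (h : ℝ)
    (X : Matrix (Fin d) (Fin d) ℂ) : Matrix (Fin d) (Fin d) ℂ :=
  (X.trace / d) • 1 -
    (h : ℂ) • ∑ α, ∑ g, ∑ l,
      ((O α g l : ℝ) : ℂ) • (((X - (X.trace / d) • 1) * E α l).trace • E α g)

/-- (id ⊗ Λ) acting on matrices on ℂ^d ⊗ ℂ^d. -/
def idTensor {d : ℕ} (Λ : Matrix (Fin d) (Fin d) ℂ → Matrix (Fin d) (Fin d) ℂ)
    (ρ : Matrix (Fin d × Fin d) (Fin d × Fin d) ℂ) :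
    Matrix (Fin d × Fin d) (Fin d × Fin d) ℂ :=
  Matrix.of fun p q => Λ (Matrix.of fun a b => ρ (p.1, a) (q.1, b)) p.2 q.2

/-- Rank-one projection |ψ⟩⟨ψ|. -/
def proj {n : Type*} (ψ : n → ℂ) : Matrix n n ℂ := Matrix.vecMulVec ψ (star ψ)

/-- The maximally entangled vector of Schmidt rank k, rotated by U ⊗ V. -/
def psiK (d k : ℕ) (U V : Matrix (Fin d) (Fin d) ℂ) : Fin d × Fin d → ℂ :=
  (U ⊗ₖ V).mulVec fun p =>
    if p.1 = p.2 ∧ (p.1 : ℕ) < k then (((1 : ℝ) / Real.sqrt k : ℝ) : ℂ) else 0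

/-- The Schmidt-number witness W_k. -/
def Wit {d N M : ℕ} (E : Fin N → Fin M → Matrix (Fin d) (Fin d) ℂ)
    (O : Fin N → Matrix (Fin M) (Fin M) ℝ) (h : ℝ) :
    Matrix (Fin d × Fin d) (Fin d × Fin d) ℂ :=
  ((((M : ℝ) + N * d * h) / (d * M) : ℝ) : ℂ) • 1 -
    (h : ℂ) • ∑ α, ∑ g, ∑ l,
      ((O α g l : ℝ) : ℂ) • ((E α l).map (starRingEnd ℂ) ⊗ₖ E α g)

/-- ρ has Schmidt number at most k. -/
def SchmidtNumberLE (d k : ℕ) (ρ : Matrix (Fin d × Fin d) (Fin d × Fin d) ℂ) : Prop :=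
  ∃ (n : ℕ) (p : Fin n → ℝ) (ψ : Fin n → (Fin d × Fin d → ℂ)),
    (∀ i, 0 ≤ p i) ∧ (∑ i, p i = 1) ∧
    (∀ i, ∑ q, ‖ψ i q‖ ^ 2 = 1) ∧
    (∀ i, (Matrix.of fun a b => ψ i (a, b)).rank ≤ k) ∧
    ρ = ∑ i, ((p i : ℝ) : ℂ) • proj (ψ i)

/-- The maximally entangled vector |ψ_d⟩. -/
def psiD (d : ℕ) : Fin d × Fin d → ℂ :=
  fun p => if p.1 = p.2 then (((1 : ℝ) / Real.sqrt d : ℝ) : ℂ) else 0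

/-- The isotropic state ρ_v. -/
def isoState (d : ℕ) (v : ℝ) : Matrix (Fin d × Fin d) (Fin d × Fin d) ℂ :=
  (v : ℂ) • proj (psiD d) + (((1 - v) / (d : ℝ) ^ 2 : ℝ) : ℂ) • 1

/-- The overlap of `conj A ⊗ B` with the maximally entangled state is `Tr(A† B) / d`. -/
lemma trace_conj_kronecker_mul_proj_psiD {d : ℕ} (A B : Matrix (Fin d) (Fin d) ℂ) :
    ((A.map (starRingEnd ℂ) ⊗ₖ B) * proj (psiD d)).trace = (Aᴴ * B).trace / d := by
  have hs : (((Real.sqrt d : ℝ) : ℂ))⁻¹ * ((Real.sqrt d : ℝ) : ℂ)⁻¹ = (d : ℂ)⁻¹ := by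
    rw [← mul_inv, ← Complex.ofReal_mul, Real.mul_self_sqrt (Nat.cast_nonneg d),
      Complex.ofReal_natCast]
  rw [proj, Matrix.mul_vecMulVec, Matrix.trace_vecMulVec]
  simp only [psiD, dotProduct, mulVec, Fintype.sum_prod_type, Pi.star_apply, kroneckerMap_apply,
    Matrix.map_apply, apply_ite star, star_zero, mul_ite, mul_zero, Finset.sum_ite_eq,
    Finset.mem_univ, if_true, Matrix.trace, Matrix.diag_apply, Matrix.mul_apply,
    conjTranspose_apply, Finset.sum_div]
  rw [Finset.sum_comm]
  refine Finset.sum_congr rfl fun i _ => ?_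
  simp only [Finset.sum_mul, one_div, Complex.ofReal_inv, RCLike.star_def, map_inv₀,
    Complex.conj_ofReal]
  refine Finset.sum_congr rfl fun j _ => ?_
  linear_combination (starRingEnd ℂ (A i j) * B i j) * hs

/-- The maximally entangled state has trace one. -/
lemma trace_proj_psiD {d : ℕ} (hd : d ≠ 0) : (proj (psiD d)).trace = 1 := by
  have h := trace_conj_kronecker_mul_proj_psiD (1 : Matrix (Fin d) (Fin d) ℂ) 1
  rw [Matrix.map_one _ (map_zero _) (map_one _), one_kronecker_one, one_mul] at h
  rw [h]
  simp [hd]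

lemma trace_mul_isoState {d : ℕ} (W : Matrix (Fin d × Fin d) (Fin d × Fin d) ℂ) (v : ℝ) :
    (W * isoState d v).trace =
      v * (W * proj (psiD d)).trace + (((1 - v) / (d : ℝ) ^ 2 : ℝ) : ℂ) * W.trace := by
  simp only [isoState, mul_add, Matrix.mul_smul, mul_one, trace_add, trace_smul, smul_eq_mul]

lemma Wit_one {d N M : ℕ} (E : Fin N → Fin M → Matrix (Fin d) (Fin d) ℂ) (h : ℝ) :
    Wit E (fun _ => (1 : Matrix (Fin M) (Fin M) ℝ)) h =
      ((((M : ℝ) + N * d * h) / (d * M) : ℝ) : ℂ) • 1 -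
        (h : ℂ) • ∑ α, ∑ g, (E α g).map (starRingEnd ℂ) ⊗ₖ E α g := by
  simp [Wit, Matrix.one_apply, apply_ite (Complex.ofReal), ite_smul]

lemma trace_Wit_one {d N M : ℕ} {x : ℝ} {E : Fin N → Fin M → Matrix (Fin d) (Fin d) ℂ}
    (hE : IsICPOVM d N M x E) (hd : d ≠ 0) (hM : M ≠ 0) (h : ℝ) :
    (Wit E (fun _ => (1 : Matrix (Fin M) (Fin M) ℝ)) h).trace = d := by
  have hterm (α g) : ((E α g).map (starRingEnd ℂ) ⊗ₖ E α g).trace = ((d : ℂ) / M) ^ 2 := by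
    have hc : ((E α g).map (starRingEnd ℂ)).trace = starRingEnd ℂ (E α g).trace := by
      simp [Matrix.trace]
    rw [trace_kronecker, hc, hE.2.2.1 α g]
    simp [sq]
  have hd' : (d : ℂ) ≠ 0 := by exact_mod_cast hd
  have hM' : (M : ℂ) ≠ 0 := by exact_mod_cast hM
  simp only [Wit_one, trace_sub, trace_smul, trace_sum, hterm, trace_one, Finset.sum_const,
    Finset.card_univ, Fintype.card_fin, Fintype.card_prod, nsmul_eq_mul, smul_eq_mul]
  push_cast
  field_simp
  ring

lemma trace_Wit_one_mul_proj_psiD {d N M : ℕ} {x : ℝ}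
    {E : Fin N → Fin M → Matrix (Fin d) (Fin d) ℂ}
    (hE : IsICPOVM d N M x E) (hd : d ≠ 0) (hM : M ≠ 0) (h : ℝ) :
    (Wit E (fun _ => (1 : Matrix (Fin M) (Fin M) ℝ)) h * proj (psiD d)).trace =
      ((1 / d - h * N * ((M : ℝ) ^ 2 * x - d) / (d * M) : ℝ) : ℂ) := by
  have hterm (α g) : (((E α g).map (starRingEnd ℂ) ⊗ₖ E α g) * proj (psiD d)).trace =
      (x : ℂ) / d := by
    rw [trace_conj_kronecker_mul_proj_psiD, (hE.1 α g).isHermitian.eq, hE.2.2.2.1 α g]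
  have hd' : (d : ℂ) ≠ 0 := by exact_mod_cast hd
  have hM' : (M : ℂ) ≠ 0 := by exact_mod_cast hM
  simp only [Wit_one, sub_mul, Matrix.smul_mul, Matrix.sum_mul, one_mul, trace_sub, trace_smul,
    trace_sum, hterm, trace_proj_psiD hd, Finset.sum_const, Finset.card_univ, Fintype.card_fin,
    nsmul_eq_mul, smul_eq_mul]
  push_cast
  field_simp
  ring

lemma trace_Wit_one_mul_isoState {d N M : ℕ} {x : ℝ}
    {E : Fin N → Fin M → Matrix (Fin d) (Fin d) ℂ}
    (hE : IsICPOVM d N M x E) (hd : d ≠ 0) (hM : M ≠ 0) (h v : ℝ) :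
    (Wit E (fun _ => (1 : Matrix (Fin M) (Fin M) ℝ)) h * isoState d v).trace =
      (((1 - v * (h * N * ((M : ℝ) ^ 2 * x - d) / M)) / d : ℝ) : ℂ) := by
  have hd' : (d : ℂ) ≠ 0 := by exact_mod_cast hd
  have hM' : (M : ℂ) ≠ 0 := by exact_mod_cast hM
  rw [trace_mul_isoState, trace_Wit_one hE hd hM, trace_Wit_one_mul_proj_psiD hE hd hM]
  push_cast
  field_simp
  ring

/-- for v above the threshold, Tr(W_k ρ_v) < 0. -/
theorem witness_negative_on_isotropic (d N M k : ℕ)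
    (hd : 2 ≤ d) (hN : 2 ≤ N) (hM : 2 ≤ M)
    (hdim : N * (M - 1) = d ^ 2 - 1) (x : ℝ)
    (E : Fin N → Fin M → Matrix (Fin d) (Fin d) ℂ) (hE : IsICPOVM d N M x E)
    (hk1 : 1 ≤ k) (hkd : k ≤ d)
    (v : ℝ) (hv0 : 0 < v) (hv1 : v ≤ 1)
    (hv : (M : ℝ) * ((k : ℝ) * d - 1) * Real.sqrt (x * ((M : ℝ) ^ 2 * x - d)) /
        ((N : ℝ) * ((M : ℝ) ^ 2 * x - d) * Real.sqrt ((M : ℝ) * ((M : ℝ) - 1))) < v) :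
    (Wit E (fun _ => (1 : Matrix (Fin M) (Fin M) ℝ)) (hx d M k x) * isoState d v).trace
      < 0 := by
  have hd0 : (0 : ℝ) < d := by exact_mod_cast (by omega : 0 < d)
  have hM2 : (2 : ℝ) ≤ M := by exact_mod_cast hM
  have hM0 : (0 : ℝ) < M := by linarith
  have hN0 : (0 : ℝ) < N := by exact_mod_cast (by omega : 0 < N)
  have hx1 : (d : ℝ) / (M : ℝ) ^ 2 < x := hE.2.2.2.2.2.2.1
  have hx0 : 0 < x := lt_trans (by positivity) hx1
  have hy : 0 < (M : ℝ) ^ 2 * x - d := by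
    rw [div_lt_iff₀ (by positivity)] at hx1
    linarith
  have hkd1 : 0 < (k : ℝ) * d - 1 := by
    have h1 : (1 : ℝ) ≤ k := by exact_mod_cast hk1
    have h2 : (2 : ℝ) ≤ d := by exact_mod_cast hd
    nlinarith
  have hs : 0 < Real.sqrt (x * ((M : ℝ) ^ 2 * x - d)) := Real.sqrt_pos.2 (by positivity)
  have ht : 0 < Real.sqrt ((M : ℝ) * ((M : ℝ) - 1)) :=
    Real.sqrt_pos.2 (mul_pos hM0 (by linarith))
  rw [trace_Wit_one_mul_isoState hE (by omega) (by omega), ← Complex.ofReal_zero,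
    Complex.real_lt_real]
  refine div_neg_of_neg_of_pos (sub_neg.2 ?_) hd0
  rw [div_lt_iff₀ (by positivity)] at hv
  rw [hx, Real.sqrt_div' _ (by positivity)]
  generalize Real.sqrt (x * ((M : ℝ) ^ 2 * x - d)) = s at *
  generalize Real.sqrt ((M : ℝ) * ((M : ℝ) - 1)) = t at *
  field_simp
  linarith
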